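/- arXiv:hep-th/9910173 — 4 statements merged into one kernel-verified Lean document; each statement's English description precedes it below -/
import Mathlib

section
/- Let B : ℝ → Matrix (Fin n) (Fin n) ℂ be continuous, a ∈ ℝ, and let Q be the solution of Q'(x) = B(x) * Q(x) with Q(a) = 1. Let P : ℝ → Matrix (Fin n) (Fin n) ℂ be continuously differentiable with invertible values. Then the function x ↦ P(x) * Q(x) * P(a)⁻¹ is the unique solution F of F'(x) = (P'(x) * P(x)⁻¹ + P(x) * B(x) * P(x)⁻¹) * F(x) with F(a) = 1; that is, the similarity theorem P(x) · ∏_a^x e^{B(s)ds} · P(a)⁻¹ = ∏_a^x e^{[LP(s)+P(s)B(s)P(s)⁻¹]ds} holds, where (LP)(s) = P'(s) * P(s)⁻¹. -/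
attribute [local instance] Matrix.linftyOpNormedAddCommGroup Matrix.linftyOpNormedRing
  Matrix.linftyOpNormedSpace Matrix.linftyOpNormedAlgebra

section LinearODE

variable {A : Type*} [NormedRing A] [NormedAlgebra ℝ A]

/-- A solution of a homogeneous linear equation `F' = C * F` that vanishes at `a`
vanishes to the right of `a`. -/
theorem eq_zero_of_hasDerivAt_mul_of_le {C F : ℝ → A} (hC : Continuous C) {a : ℝ}
    (hF : ∀ x, HasDerivAt F (C x * F x) x) (ha : F a = 0) {x : ℝ} (hx : a ≤ x) : F x = 0 := by
  obtain ⟨K, hK⟩ := (isCompact_Icc (a := a) (b := x)).exists_bound_of_continuousOn hC.continuousOn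
  refine eq_zero_of_abs_deriv_le_mul_abs_self_of_eq_zero_right (K := K)
    (fun y _ => (hF y).continuousAt.continuousWithinAt) (fun y _ => (hF y).hasDerivWithinAt) ha
    (fun y hy => ?_) x ⟨hx, le_rfl⟩
  exact (norm_mul_le _ _).trans
    (mul_le_mul_of_nonneg_right (hK y ⟨hy.1, hy.2.le⟩) (norm_nonneg _))

/-- A solution of a homogeneous linear equation `F' = C * F` that vanishes at one point
vanishes everywhere. -/
theorem eq_zero_of_hasDerivAt_mul {C F : ℝ → A} (hC : Continuous C) {a : ℝ}
    (hF : ∀ x, HasDerivAt F (C x * F x) x) (ha : F a = 0) (x : ℝ) : F x = 0 := by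
  rcases le_total a x with hx | hx
  · exact eq_zero_of_hasDerivAt_mul_of_le hC hF ha hx
  · have hrefl : ∀ y, HasDerivAt (fun t => F (-t)) (-C (-y) * F (-y)) y := fun y => by
      simpa [Function.comp_def] using (hF (-y)).scomp y (hasDerivAt_neg y)
    simpa using eq_zero_of_hasDerivAt_mul_of_le (hC.comp continuous_neg).neg hrefl
      (a := -a) (by simpa using ha) (neg_le_neg hx)

/-- Solutions of `F' = C * F` are determined by their value at one point. -/
theorem eq_of_hasDerivAt_mul {C F G : ℝ → A} (hC : Continuous C) {a : ℝ}
    (hF : ∀ x, HasDerivAt F (C x * F x) x) (hG : ∀ x, HasDerivAt G (C x * G x) x)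
    (ha : F a = G a) : F = G := by
  funext x
  refine sub_eq_zero.mp
    (eq_zero_of_hasDerivAt_mul (F := F - G) hC (fun y => ?_) (sub_eq_zero.mpr ha) x)
  simpa only [Pi.sub_apply, mul_sub] using (hF y).sub (hG y)

end LinearODE

theorem Continuous.matrix_inv_of_isUnit {X : Type*} [TopologicalSpace X] {n : ℕ}
    {P : X → Matrix (Fin n) (Fin n) ℂ} (hP : Continuous P) (hPinv : ∀ x, IsUnit (P x)) :
    Continuous fun x => (P x)⁻¹ := by
  simp only [Matrix.inv_def, Ring.inverse_eq_inv']
  exact (hP.matrix_det.inv₀ fun x => ((Matrix.isUnit_iff_isUnit_det _).mp (hPinv x)).ne_zero).smul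
    hP.matrix_adjugate

/-- The similarity theorem for product integrals:
`P x · ∏_a^x e^{B(s)ds} · (P a)⁻¹ = ∏_a^x e^{[LP(s) + P s B s (P s)⁻¹]ds}`,
where `(LP)(s) = P'(s) * (P s)⁻¹`; i.e. `x ↦ P x * Q x * (P a)⁻¹` is the unique solution
of `F' = (LP + P·B·P⁻¹)·F`, `F a = 1`. -/
theorem product_integral_similarity (n : ℕ)
    (B : ℝ → Matrix (Fin n) (Fin n) ℂ) (hB : Continuous B) (a : ℝ)
    (Q : ℝ → Matrix (Fin n) (Fin n) ℂ)
    (hQ : ∀ x : ℝ, HasDerivAt Q (B x * Q x) x) (hQa : Q a = 1)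
    (P : ℝ → Matrix (Fin n) (Fin n) ℂ) (hP : ContDiff ℝ 1 P)
    (hPinv : ∀ x : ℝ, IsUnit (P x)) :
    ((∀ x : ℝ, HasDerivAt (fun y : ℝ => P y * Q y * (P a)⁻¹)
        ((deriv P x * (P x)⁻¹ + P x * B x * (P x)⁻¹) * (P x * Q x * (P a)⁻¹)) x) ∧
      P a * Q a * (P a)⁻¹ = 1) ∧
    ∀ F : ℝ → Matrix (Fin n) (Fin n) ℂ,
      (∀ x : ℝ, HasDerivAt F ((deriv P x * (P x)⁻¹ + P x * B x * (P x)⁻¹) * F x) x) →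
        F a = 1 → F = fun x : ℝ => P x * Q x * (P a)⁻¹ := by
  have hinv (x : ℝ) : (P x)⁻¹ * P x = 1 :=
    Matrix.nonsing_inv_mul _ ((Matrix.isUnit_iff_isUnit_det _).mp (hPinv x))
  have hinva : P a * Q a * (P a)⁻¹ = 1 := by
    rw [hQa, mul_one, Matrix.mul_nonsing_inv _ ((Matrix.isUnit_iff_isUnit_det _).mp (hPinv a))]
  have hderiv (x : ℝ) : HasDerivAt (fun y : ℝ => P y * Q y * (P a)⁻¹)
      ((deriv P x * (P x)⁻¹ + P x * B x * (P x)⁻¹) * (P x * Q x * (P a)⁻¹)) x := by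
    have hPx : HasDerivAt P (deriv P x) x := (hP.differentiable one_ne_zero x).hasDerivAt
    refine ((hPx.mul (hQ x)).mul_const (P a)⁻¹).congr_deriv (Eq.symm ?_)
    calc _ = (deriv P x * ((P x)⁻¹ * P x) * Q x + P x * B x * ((P x)⁻¹ * P x) * Q x) *
          (P a)⁻¹ := by noncomm_ring
      _ = _ := by rw [hinv]; noncomm_ring
  have hPinv_cont := hP.continuous.matrix_inv_of_isUnit hPinv
  have hC : Continuous fun x => deriv P x * (P x)⁻¹ + P x * B x * (P x)⁻¹ :=
    ((hP.continuous_deriv le_rfl).mul hPinv_cont).add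
      ((hP.continuous.mul hB).mul hPinv_cont)
  exact ⟨⟨hderiv, hinva⟩, fun F hF hFa =>
    eq_of_hasDerivAt_mul hC hF hderiv (hFa.trans hinva.symm)⟩
end

section
/- (Theorem 1, non-abelian Stokes theorem, first form.) With the Wilson-loop setup below, fix σ ∈ ℝ and let Y : ℝ → Matrix (Fin n) (Fin n) ℂ be the unique solution of Y'(τ') = T(σ, τ')⁻¹ * (A₀(σ, τ') − ∂_τ T(σ, τ') * T(σ, τ')⁻¹) * T(σ, τ') * Y(τ') with Y(τ₀) = 1. Then W(σ, τ) = Y(τ) for every τ ∈ ℝ; that is, W = ∏_{τ₀}^{τ} e^{T⁻¹(σ,τ')[A₀(σ,τ') − L_τ T(σ,τ')]T(σ,τ') dτ'}. -/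
attribute [local instance] Matrix.linftyOpNormedAddCommGroup Matrix.linftyOpNormedRing
  Matrix.linftyOpNormedSpace Matrix.linftyOpNormedAlgebra

section NormedAlgebra

open Set Filter Topology MeasureTheory

variable {R : Type*} [NormedRing R] [NormedAlgebra ℝ R] [CompleteSpace R]

/-- The derivative of the pointwise inverse of a curve through the units of a normed algebra. -/
theorem HasDerivAt.ringInverse_comp {f : ℝ → R} {f' : R} {x : ℝ} (hf : HasDerivAt f f' x)
    (hx : IsUnit (f x)) :
    HasDerivAt (fun y => Ring.inverse (f y))
      (-(Ring.inverse (f x) * f' * Ring.inverse (f x))) x := by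
  obtain ⟨u, hu⟩ := hx
  have h := hasFDerivAt_ringInverse (𝕜 := ℝ) u
  rw [hu] at h
  rw [← hu, Ring.inverse_unit]
  simpa using! h.comp_hasDerivAt x hf

/-- The product of a function that is differentiable and vanishes at a point with a function that
is merely continuous there is differentiable at that point. -/
theorem HasDerivAt.mul_continuousAt_of_eq_zero {R : Type*} [NormedRing R] [NormedAlgebra ℝ R]
    {f g : ℝ → R} {f' : R} {x : ℝ}
    (hf : HasDerivAt f f' x) (hg : ContinuousAt g x) (h0 : f x = 0) :
    HasDerivAt (fun y => f y * g y) (f' * g x) x := by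
  rw [hasDerivAt_iff_tendsto_slope] at hf ⊢
  refine (hf.mul (hg.tendsto.mono_left nhdsWithin_le_nhds)).congr fun y => ?_
  simp [slope_def_module, h0]

/-- Two fundamental solutions of linear equations differ by Duhamel's formula. -/
theorem fundamentalSolution_eq_mul_one_add_integral {a b p q : ℝ → R}
    (ha : Continuous a) (hb : Continuous b)
    (hp : ∀ s, HasDerivAt p (a s * p s) s) (hq : ∀ s, HasDerivAt q (b s * q s) s)
    (hp0 : p 0 = 1) (hq0 : q 0 = 1) (hu : ∀ s, IsUnit (p s)) (t : ℝ) :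
    q t = p t * (1 + ∫ s in (0 : ℝ)..t, Ring.inverse (p s) * (b s - a s) * q s) := by
  have hpc : Continuous p := continuous_iff_continuousAt.2 fun s => (hp s).continuousAt
  have hqc : Continuous q := continuous_iff_continuousAt.2 fun s => (hq s).continuousAt
  have hic : Continuous fun s => Ring.inverse (p s) := continuous_iff_continuousAt.2 fun s =>
    ((hp s).ringInverse_comp (hu s)).continuousAt
  have hd : ∀ s, HasDerivAt (fun s => Ring.inverse (p s) * q s)
      (Ring.inverse (p s) * (b s - a s) * q s) s := by
    intro s
    refine (((hp s).ringInverse_comp (hu s)).mul (hq s)).congr_deriv ?_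
    have := Ring.mul_inverse_cancel _ (hu s)
    rw [mul_assoc, mul_assoc (a s), this]
    noncomm_ring
  have := intervalIntegral.integral_eq_sub_of_hasDerivAt (fun s _ => hd s)
    (Continuous.intervalIntegrable (by fun_prop) 0 t)
  rw [this, hp0, hq0, Ring.inverse_one, mul_one, add_sub_cancel, ← mul_assoc,
    Ring.mul_inverse_cancel _ (hu t), one_mul]

/-- The time-one value of the fundamental solution of a linear ordinary differential equation is
differentiable in a parameter on which the coefficient depends continuously differentiably. -/
theorem differentiableAt_fundamentalSolution_one {A P : ℝ → ℝ → R}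
    (hA : ContDiff ℝ 1 fun p : ℝ × ℝ => A p.1 p.2)
    (hP : ∀ s τ, HasDerivAt (fun s' => P s' τ) (A s τ * P s τ) s)
    (hP0 : ∀ τ, P 0 τ = 1) (hu : ∀ s τ, IsUnit (P s τ)) (τ : ℝ) :
    DifferentiableAt ℝ (P 1) τ := by
  have hAc := hA.continuous
  have hAs : ∀ t, Continuous fun s => A s t := fun t =>
    hAc.comp (by fun_prop : Continuous fun s : ℝ => (s, t))
  have hPc : ∀ t, Continuous fun s => P s t := fun t =>
    continuous_iff_continuousAt.2 fun s => (hP s t).continuousAt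
  have hIc : Continuous fun s => Ring.inverse (P s τ) := continuous_iff_continuousAt.2 fun s =>
    ((hP s τ).ringInverse_comp (hu s τ)).continuousAt
  have hKc : IsCompact (Icc (0 : ℝ) 1 ×ˢ Icc (τ - 1) (τ + 1)) := isCompact_Icc.prod isCompact_Icc
  obtain ⟨L, hL⟩ := hA.contDiffOn.exists_lipschitzOnWith one_ne_zero
    ((convex_Icc _ _).prod (convex_Icc _ _)) hKc
  obtain ⟨K, hK⟩ := hKc.exists_bound_of_continuousOn hAc.continuousOn
  obtain ⟨M, hM⟩ := isCompact_Icc.exists_bound_of_continuousOn (s := Icc (0 : ℝ) 1)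
    (hPc τ).continuousOn
  obtain ⟨C, hC⟩ := isCompact_Icc.exists_bound_of_continuousOn (s := Icc (0 : ℝ) 1)
    hIc.continuousOn
  have h01 : (0 : ℝ) ∈ Icc (0 : ℝ) 1 := by simp
  have hτ : τ ∈ Icc (τ - 1) (τ + 1) := by constructor <;> linarith
  have hM0 : 0 ≤ M := (norm_nonneg _).trans (hM 0 h01)
  have hC0 : 0 ≤ C := (norm_nonneg _).trans (hC 0 h01)
  have hK0 : 0 ≤ K := (norm_nonneg _).trans (hK (0, τ) ⟨h01, hτ⟩)
  have hlip : ∀ s ∈ Icc (0 : ℝ) 1, ∀ t ∈ Icc (τ - 1) (τ + 1),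
      ‖A s t - A s τ‖ ≤ L * ‖t - τ‖ := by
    intro s hs t ht
    have := hL.norm_sub_le (x := (s, t)) (y := (s, τ)) ⟨hs, ht⟩ ⟨hs, hτ⟩
    simpa [Prod.norm_def] using this
  have hbound : ∀ t ∈ Icc (τ - 1) (τ + 1), ∀ s ∈ Icc (0 : ℝ) 1,
      ‖P s t‖ ≤ ‖(1 : R)‖ * Real.exp K := by
    intro t ht s hs
    have := norm_le_gronwallBound_of_norm_deriv_right_le (K := K) (ε := 0) (δ := ‖(1 : R)‖)
      (hPc t).continuousOn (fun s _ => (hP s t).hasDerivWithinAt) (by rw [hP0])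
      (fun s hs => by
        rw [add_zero]
        exact (norm_mul_le _ _).trans (by
          gcongr; exact hK (s, t) ⟨Ico_subset_Icc_self hs, ht⟩)) s hs
    rw [gronwallBound_ε0, sub_zero] at this
    refine this.trans ?_
    gcongr
    exact mul_le_of_le_one_right hK0 hs.2
  have hdiff : ∀ s ∈ Icc (0 : ℝ) 1, ∀ t ∈ Icc (τ - 1) (τ + 1),
      ‖P s t - P s τ‖ ≤ gronwallBound 0 K (L * ‖t - τ‖ * M) s := by
    intro s hs t ht
    have := norm_le_gronwallBound_of_norm_deriv_right_le (K := K) (ε := L * ‖t - τ‖ * M) (δ := 0)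
      ((hPc t).sub (hPc τ)).continuousOn
      (fun s _ => ((hP s t).sub (hP s τ)).hasDerivWithinAt) (by simp [hP0])
      (fun s hs => by
        have hs' := Ico_subset_Icc_self hs
        have h : A s t * P s t - A s τ * P s τ =
          A s t * (P s t - P s τ) + (A s t - A s τ) * P s τ := by noncomm_ring
        rw [h]
        refine (norm_add_le _ _).trans (add_le_add ((norm_mul_le _ _).trans ?_)
          ((norm_mul_le _ _).trans ?_))
        · gcongr
          · exact hK (s, t) ⟨hs', ht⟩
          · rfl
        · gcongr
          · exact hlip s hs' t ht
          · exact hM s hs') s hs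
    simpa using this
  have hnhds : Icc (τ - 1) (τ + 1) ∈ 𝓝 τ := Icc_mem_nhds (by linarith) (by linarith)
  have hcont : ∀ s ∈ Icc (0 : ℝ) 1, ContinuousAt (P s) τ := by
    intro s hs
    rw [ContinuousAt, tendsto_iff_norm_sub_tendsto_zero]
    refine squeeze_zero' (Eventually.of_forall fun _ => norm_nonneg _)
      (by filter_upwards [hnhds] with t ht using hdiff s hs t ht) ?_
    have h : Continuous fun t : ℝ => gronwallBound 0 K (L * ‖t - τ‖ * M) s :=
      (gronwallBound_continuous_ε 0 K s).comp (by fun_prop)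
    simpa [gronwallBound_ε0_δ0] using h.tendsto τ
  have hAd : ∀ s, DifferentiableAt ℝ (A s) τ := fun s =>
    ((hA.differentiable one_ne_zero).comp
      (by fun_prop : Differentiable ℝ fun t : ℝ => (s, t))) τ
  let G : ℝ → ℝ → R := fun t s => Ring.inverse (P s τ) * (A s t - A s τ) * P s t
  have hGc : ∀ t, Continuous (G t) := fun t =>
    (hIc.mul ((hAs t).sub (hAs τ))).mul (hPc t)
  have hGd : ∀ s ∈ Icc (0 : ℝ) 1, HasDerivAt (fun t => G t s)
      (Ring.inverse (P s τ) * deriv (A s) τ * P s τ) τ := by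
    intro s hs
    exact (((hAd s).hasDerivAt.sub_const (A s τ)).const_mul _).mul_continuousAt_of_eq_zero
      (hcont s hs) (by simp)
  have hdc : Continuous fun s => deriv (A s) τ := by
    have h : ∀ s, deriv (A s) τ = fderiv ℝ (fun p : ℝ × ℝ => A p.1 p.2) (s, τ) (0, 1) := fun s =>
      ((hA.differentiable one_ne_zero (s, τ)).hasFDerivAt.comp_hasDerivAt τ
        ((hasDerivAt_const τ s).prodMk (hasDerivAt_id τ))).deriv
    simp only [h]
    exact ((hA.continuous_fderiv one_ne_zero).comp
      (by fun_prop : Continuous fun s : ℝ => (s, τ))).clm_apply continuous_const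
  have hint : DifferentiableAt ℝ (fun t => ∫ s in Ioc (0 : ℝ) 1, G t s) τ := by
    have := hasFDerivAt_integral_of_dominated_loc_of_lip' (𝕜 := ℝ) (F := G) (x₀ := τ)
      (μ := volume.restrict (Ioc (0 : ℝ) 1)) (s := Icc (τ - 1) (τ + 1))
      (F' := fun s => ContinuousLinearMap.toSpanSingleton ℝ
        (Ring.inverse (P s τ) * deriv (A s) τ * P s τ))
      (bound := fun _ => C * L * (‖(1 : R)‖ * Real.exp K)) hnhds
      (fun t _ => (hGc t).aestronglyMeasurable)
      ((hGc τ).integrableOn_Ioc)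
      ((ContinuousLinearMap.toSpanSingletonCLE (𝕜 := ℝ)).continuous.comp
        ((hIc.mul hdc).mul (hPc τ))).aestronglyMeasurable
      ((ae_restrict_mem measurableSet_Ioc).mono fun s hs t ht => ?_)
      (integrable_const _)
      ((ae_restrict_mem measurableSet_Ioc).mono fun s hs =>
        (hGd s (Ioc_subset_Icc_self hs)).hasFDerivAt)
    · exact this.2.differentiableAt
    · have hs' := Ioc_subset_Icc_self hs
      have h0 : G τ s = 0 := by simp [G]
      rw [h0, sub_zero]
      calc ‖G t s‖ ≤ ‖Ring.inverse (P s τ)‖ * ‖A s t - A s τ‖ * ‖P s t‖ := norm_mul₃_le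
        _ ≤ C * (L * ‖t - τ‖) * (‖(1 : R)‖ * Real.exp K) := by
          gcongr
          · exact hC s hs'
          · exact hlip s hs' t ht
          · exact hbound t ht s hs'
        _ = _ := by ring
  have hform : P 1 = fun t => P 1 τ * (1 + ∫ s in Ioc (0 : ℝ) 1, G t s) := by
    funext t
    rw [← intervalIntegral.integral_of_le zero_le_one]
    exact fundamentalSolution_eq_mul_one_add_integral (hAs τ) (hAs t) (fun s => hP s τ)
      (fun s => hP s t) (hP0 τ) (hP0 t) (fun s => hu s τ) 1
  rw [hform]
  exact (hint.const_add 1).const_mul _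

/-- The fundamental solution of a linear ordinary differential equation whose coefficient depends
continuously differentiably on a parameter is differentiable in that parameter. -/
theorem differentiableAt_fundamentalSolution {A P : ℝ → ℝ → R} {s₀ : ℝ}
    (hA : ContDiff ℝ 1 fun p : ℝ × ℝ => A p.1 p.2)
    (hP : ∀ s τ, HasDerivAt (fun s' => P s' τ) (A s τ * P s τ) s)
    (hP0 : ∀ τ, P s₀ τ = 1) (hu : ∀ s τ, IsUnit (P s τ)) (s τ : ℝ) :
    DifferentiableAt ℝ (P s) τ := by
  have h := differentiableAt_fundamentalSolution_one
    (A := fun r t => (s - s₀) • A (s₀ + r * (s - s₀)) t) (P := fun r t => P (s₀ + r * (s - s₀)) t)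
    ((hA.comp
      (by fun_prop : ContDiff ℝ 1 fun p : ℝ × ℝ => (s₀ + p.1 * (s - s₀), p.2))).const_smul (s - s₀))
    (fun r t => ?_) (by simpa using hP0) (fun _ _ => hu _ _) τ
  · simpa using! h
  · have hr : HasDerivAt (fun r : ℝ => s₀ + r * (s - s₀)) (s - s₀) r := by
      simpa using ((hasDerivAt_id r).mul_const (s - s₀)).const_add s₀
    simpa using! (hP (s₀ + r * (s - s₀)) t).scomp r hr

end NormedAlgebra

/-- Theorem 1 (non-abelian Stokes theorem, first form): the Wilson loop operator is the
product integral `W = ∏_{τ₀}^{τ} e^{T⁻¹(σ,τ')[A₀(σ,τ') − L_τ T(σ,τ')]T(σ,τ') dτ'}`. -/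
theorem wilson_loop_product_integral_form
    (n : ℕ) (hn : 1 ≤ n)
    (A₀ A₁ : ℝ → ℝ → Matrix (Fin n) (Fin n) ℂ)
    (hA₀ : ContDiff ℝ 1 fun p : ℝ × ℝ => A₀ p.1 p.2)
    (hA₁ : ContDiff ℝ 1 fun p : ℝ × ℝ => A₁ p.1 p.2)
    (σ₀ τ₀ : ℝ)
    (P Q : ℝ → ℝ → Matrix (Fin n) (Fin n) ℂ)
    (hP : ∀ (σ τ : ℝ), HasDerivAt (fun σ' : ℝ => P σ' τ) (A₁ σ τ * P σ τ) σ)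
    (hP0 : ∀ τ : ℝ, P σ₀ τ = 1)
    (hPinv : ∀ (σ τ : ℝ), IsUnit (P σ τ))
    (hQ : ∀ (σ τ : ℝ), HasDerivAt (fun τ' : ℝ => Q σ τ') (A₀ σ τ * Q σ τ) τ)
    (hQ0 : ∀ σ : ℝ, Q σ τ₀ = 1)
    (hQinv : ∀ (σ τ : ℝ), IsUnit (Q σ τ))
    (T : ℝ → ℝ → Matrix (Fin n) (Fin n) ℂ)
    (hT : ∀ (σ τ : ℝ), T σ τ = P σ τ * Q σ₀ τ)
    (W : ℝ → ℝ → Matrix (Fin n) (Fin n) ℂ)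
    (hW : ∀ (σ τ : ℝ), W σ τ = (T σ τ)⁻¹ * Q σ τ * P σ τ₀)
    (σ : ℝ) (Y : ℝ → Matrix (Fin n) (Fin n) ℂ)
    (hY : ∀ τ' : ℝ, HasDerivAt Y
      ((T σ τ')⁻¹ * (A₀ σ τ' - deriv (fun t : ℝ => T σ t) τ' * (T σ τ')⁻¹) * T σ τ' *
        Y τ') τ')
    (hY0 : Y τ₀ = 1) :
    ∀ τ : ℝ, W σ τ = Y τ := by
  intro τ
  have hTu : ∀ t, IsUnit (T σ t) := fun t => hT σ t ▸ (hPinv σ t).mul (hQinv σ₀ t)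
  have hTd : ∀ t, HasDerivAt (fun t => T σ t) (deriv (fun t => T σ t) t) t := by
    intro t
    have h : DifferentiableAt ℝ (P σ) t :=
      differentiableAt_fundamentalSolution hA₁ hP hP0 hPinv σ t
    simp only [hT]
    exact (h.mul (hQ σ₀ t).differentiableAt).hasDerivAt
  have hd : ∀ t, HasDerivAt (fun t => Ring.inverse (Q σ t) * T σ t * Y t) 0 t := by
    intro t
    refine ((((hQ σ t).ringInverse_comp (hQinv σ t)).mul (hTd t)).mul (hY t)).congr_deriv ?_
    have h1 := Ring.mul_inverse_cancel _ (hQinv σ t)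
    have h2 := Ring.mul_inverse_cancel _ (hTu t)
    have h3 := Ring.inverse_mul_cancel _ (hTu t)
    rw [Matrix.nonsing_inv_eq_ringInverse]
    generalize deriv (fun t => T σ t) t = D
    simp only [Pi.mul_apply, mul_assoc, mul_sub, sub_mul, neg_mul, add_mul]
    have h2' : ∀ X, T σ t * (Ring.inverse (T σ t) * X) = X := fun X => by
      rw [← mul_assoc, h2, one_mul]
    have h3' : ∀ X, Ring.inverse (T σ t) * (T σ t * X) = X := fun X => by
      rw [← mul_assoc, h3, one_mul]
    have h1' : ∀ X, Q σ t * (Ring.inverse (Q σ t) * X) = X := fun X => by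
      rw [← mul_assoc, h1, one_mul]
    simp only [h1', h2', h3']
    abel
  have hc := is_const_of_deriv_eq_zero (fun t => (hd t).differentiableAt)
    (fun t => (hd t).deriv) τ τ₀
  have hQτ := Ring.mul_inverse_cancel _ (hQinv σ τ)
  have hTτ := Ring.inverse_mul_cancel _ (hTu τ)
  simp only [hQ0, hT σ τ₀, hY0, Ring.inverse_one, one_mul, mul_one] at hc
  rw [hW, Matrix.nonsing_inv_eq_ringInverse, ← hc]
  simp only [← mul_assoc]
  rw [mul_assoc (Ring.inverse _) (Q σ τ), hQτ, mul_one, hTτ, one_mul]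
end

section
/- With the Wilson-loop setup below, for all σ, τ ∈ ℝ the partial derivative of W(σ, τ) with respect to τ exists and satisfies ∂_τ W(σ, τ) * W(σ, τ)⁻¹ = ∫_{σ₀}^{σ} T(σ', τ)⁻¹ * F₀₁(σ', τ) * T(σ', τ) dσ', where F₀₁ = ∂_σ A₀ − ∂_τ A₁ + [A₀, A₁]. -/
attribute [local instance] Matrix.linftyOpNormedAddCommGroup Matrix.linftyOpNormedRing
  Matrix.linftyOpNormedSpace Matrix.linftyOpNormedAlgebra

open Filter Topology Set

section BanachAlgebra

variable {R : Type*} [NormedRing R] [NormedAlgebra ℝ R]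

/-- Grönwall's bound for a linear equation, in either direction of time. -/
theorem norm_le_mul_exp_of_hasDerivAt_mul {a y : ℝ → R} {s₀ s₁ K : ℝ}
    (hy : ∀ s, HasDerivAt y (a s * y s) s) (ha : ∀ s ∈ uIcc s₀ s₁, ‖a s‖ ≤ K) :
    ‖y s₁‖ ≤ ‖y s₀‖ * Real.exp (|s₁ - s₀| * K) := by
  set c : ℝ → ℝ := fun u => s₀ + u * (s₁ - s₀) with hc
  have hcd : ∀ u, HasDerivAt c (s₁ - s₀) u := fun u => by
    simpa [hc] using ((hasDerivAt_id u).mul_const (s₁ - s₀)).const_add s₀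
  have hd : ∀ u, HasDerivAt (fun u => y (c u)) ((s₁ - s₀) • (a (c u) * y (c u))) u :=
    fun u => (hy (c u)).scomp u (hcd u)
  have hmem : ∀ u ∈ Ico (0 : ℝ) 1, c u ∈ uIcc s₀ s₁ := by
    intro u hu
    rw [← segment_eq_uIcc]
    refine ⟨1 - u, u, by linarith [hu.2], hu.1, by ring, ?_⟩
    simp only [hc, smul_eq_mul]
    ring
  have key := norm_le_gronwallBound_of_norm_deriv_right_le (f := fun u => y (c u))
    (δ := ‖y s₀‖) (K := |s₁ - s₀| * K) (ε := 0) (a := 0) (b := 1)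
    (fun u _ => (hd u).continuousAt.continuousWithinAt)
    (fun u _ => (hd u).hasDerivWithinAt) (by simp [hc])
    (fun u hu => by
      rw [norm_smul, Real.norm_eq_abs, add_zero, mul_assoc]
      gcongr
      exact (norm_mul_le _ _).trans (by gcongr; exact ha _ (hmem u hu)))
    1 (by simp)
  simpa [hc, gronwallBound_ε0] using key

theorem ContDiff.hasDerivAt_snd {A : ℝ → ℝ → R} (hA : ContDiff ℝ 1 fun p : ℝ × ℝ => A p.1 p.2)
    (s t : ℝ) :
    HasDerivAt (fun t' => A s t') (fderiv ℝ (fun p : ℝ × ℝ => A p.1 p.2) (s, t) (0, 1)) t :=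
  ((hA.differentiable one_ne_zero (s, t)).hasFDerivAt).comp_hasDerivAt t
    ((hasDerivAt_const t s).prodMk (hasDerivAt_id t))

theorem ContDiff.hasDerivAt_fst {A : ℝ → ℝ → R} (hA : ContDiff ℝ 1 fun p : ℝ × ℝ => A p.1 p.2)
    (s t : ℝ) :
    HasDerivAt (fun s' => A s' t) (fderiv ℝ (fun p : ℝ × ℝ => A p.1 p.2) (s, t) (1, 0)) s :=
  ((hA.differentiable one_ne_zero (s, t)).hasFDerivAt).comp_hasDerivAt
    (f := fun s' => (s', t)) s ((hasDerivAt_id s).prodMk (hasDerivAt_const s t))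

theorem ContDiff.continuous_deriv_snd {A : ℝ → ℝ → R}
    (hA : ContDiff ℝ 1 fun p : ℝ × ℝ => A p.1 p.2) :
    Continuous fun p : ℝ × ℝ => deriv (fun t => A p.1 t) p.2 := by
  simp_rw [fun p : ℝ × ℝ => (hA.hasDerivAt_snd p.1 p.2).deriv]
  exact (hA.continuous_fderiv one_ne_zero).clm_apply continuous_const

theorem ContDiff.continuous_deriv_fst {A : ℝ → ℝ → R}
    (hA : ContDiff ℝ 1 fun p : ℝ × ℝ => A p.1 p.2) :
    Continuous fun p : ℝ × ℝ => deriv (fun s => A s p.2) p.1 := by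
  simp_rw [fun p : ℝ × ℝ => (hA.hasDerivAt_fst p.1 p.2).deriv]
  exact (hA.continuous_fderiv one_ne_zero).clm_apply continuous_const

variable [CompleteSpace R]

theorem HasDerivAt.ringInverse {f : ℝ → R} {f' : R} {x : ℝ} (hf : HasDerivAt f f' x)
    (hu : IsUnit (f x)) :
    HasDerivAt (fun y => Ring.inverse (f y))
      (-(Ring.inverse (f x) * f' * Ring.inverse (f x))) x := by
  obtain ⟨u, hu⟩ := hu
  have h := hasFDerivAt_ringInverse (𝕜 := ℝ) u
  rw [hu] at h
  have h' := h.comp_hasDerivAt x hf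
  simpa [Function.comp_def, ← hu] using h'

section Parameter

variable {A P : ℝ → ℝ → R} {σ₀ : ℝ}

theorem inverse_mul_sub_one_eq_integral (hA : ContDiff ℝ 1 fun p : ℝ × ℝ => A p.1 p.2)
    (hP : ∀ σ τ, HasDerivAt (fun s => P s τ) (A σ τ * P σ τ) σ) (hP0 : ∀ τ, P σ₀ τ = 1)
    (hu : ∀ σ τ, IsUnit (P σ τ)) (σ τ t : ℝ) :
    Ring.inverse (P σ τ) * P σ t - 1 =
      ∫ s in σ₀..σ, Ring.inverse (P s τ) * (A s t - A s τ) * P s t := by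
  have hd : ∀ s, HasDerivAt (fun s => Ring.inverse (P s τ) * P s t)
      (Ring.inverse (P s τ) * (A s t - A s τ) * P s t) s := fun s => by
    refine (((hP s τ).ringInverse (hu s τ)).mul (hP s t)).congr_deriv ?_
    have h := Ring.mul_inverse_cancel _ (hu s τ)
    calc _ = -(Ring.inverse (P s τ) * A s τ * (P s τ * Ring.inverse (P s τ)) * P s t)
          + Ring.inverse (P s τ) * A s t * P s t := by noncomm_ring
      _ = _ := by rw [h]; noncomm_ring
  have hcP : ∀ τ, Continuous fun s => P s τ := fun τ =>
    continuous_iff_continuousAt.2 fun s => (hP s τ).continuousAt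
  have hcI : Continuous fun s => Ring.inverse (P s τ) :=
    continuous_iff_continuousAt.2 fun s => ((hP s τ).ringInverse (hu s τ)).continuousAt
  have hcA : ∀ t, Continuous fun s => A s t := fun t =>
    continuous_iff_continuousAt.2 fun s => (hA.hasDerivAt_fst s t).continuousAt
  rw [intervalIntegral.integral_eq_sub_of_hasDerivAt (fun s _ => hd s)
    (((hcI.mul ((hcA t).sub (hcA τ))).mul (hcP t)).intervalIntegrable _ _)]
  simp [hP0]

theorem exists_norm_integrand_le (hA : ContDiff ℝ 1 fun p : ℝ × ℝ => A p.1 p.2)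
    (hP : ∀ σ τ, HasDerivAt (fun s => P s τ) (A σ τ * P σ τ) σ) (hP0 : ∀ τ, P σ₀ τ = 1)
    (hu : ∀ σ τ, IsUnit (P σ τ)) (σ τ : ℝ) :
    ∃ C, ∀ t ∈ Icc (τ - 1) (τ + 1), ∀ s ∈ uIcc σ₀ σ,
      ‖Ring.inverse (P s τ) * (A s t - A s τ) * P s t‖ ≤ C * |t - τ| := by
  have hK : IsCompact (uIcc σ₀ σ ×ˢ Icc (τ - 1) (τ + 1)) := isCompact_uIcc.prod isCompact_Icc
  obtain ⟨K, hK1⟩ := hK.exists_bound_of_continuousOn hA.continuous.continuousOn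
  obtain ⟨L, hL⟩ := hK.exists_bound_of_continuousOn hA.continuous_deriv_snd.continuousOn
  have hcI : Continuous fun s => Ring.inverse (P s τ) :=
    continuous_iff_continuousAt.2 fun s => ((hP s τ).ringInverse (hu s τ)).continuousAt
  obtain ⟨M, hM⟩ := (isCompact_uIcc (a := σ₀) (b := σ)).exists_bound_of_continuousOn
    hcI.continuousOn
  have hτ : τ ∈ Icc (τ - 1) (τ + 1) := by constructor <;> linarith
  have hK0 : 0 ≤ K := (norm_nonneg _).trans (hK1 (σ₀, τ) ⟨left_mem_uIcc, hτ⟩)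
  have hM0 : 0 ≤ M := (norm_nonneg _).trans (hM σ₀ left_mem_uIcc)
  refine ⟨M * L * (‖(1 : R)‖ * Real.exp (|σ - σ₀| * K)), fun t ht s hs => ?_⟩
  have hsub : uIcc σ₀ s ⊆ uIcc σ₀ σ := uIcc_subset_uIcc_left hs
  have h1 : ‖A s t - A s τ‖ ≤ L * |t - τ| :=
    (convex_Icc (τ - 1) (τ + 1)).norm_image_sub_le_of_norm_deriv_le
      (fun x _ => (hA.hasDerivAt_snd s x).differentiableAt)
      (fun x hx => hL (s, x) ⟨hs, hx⟩) hτ ht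
  have h2 : ‖P s t‖ ≤ ‖(1 : R)‖ * Real.exp (|σ - σ₀| * K) := by
    refine (norm_le_mul_exp_of_hasDerivAt_mul (fun s => hP s t)
      (fun r hr => hK1 (r, t) ⟨hsub hr, ht⟩)).trans ?_
    rw [hP0]
    gcongr ‖_‖ * Real.exp (?_ * K)
    exact abs_sub_left_of_mem_uIcc hs
  calc _ ≤ ‖Ring.inverse (P s τ)‖ * ‖A s t - A s τ‖ * ‖P s t‖ := norm_mul₃_le
    _ ≤ M * (L * |t - τ|) * (‖(1 : R)‖ * Real.exp (|σ - σ₀| * K)) := by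
      have hML : 0 ≤ L * |t - τ| := (norm_nonneg _).trans h1
      gcongr
      exact hM s hs
    _ = _ := by ring

theorem continuousAt_parameter (hA : ContDiff ℝ 1 fun p : ℝ × ℝ => A p.1 p.2)
    (hP : ∀ σ τ, HasDerivAt (fun s => P s τ) (A σ τ * P σ τ) σ) (hP0 : ∀ τ, P σ₀ τ = 1)
    (hu : ∀ σ τ, IsUnit (P σ τ)) (σ τ : ℝ) : ContinuousAt (fun t => P σ t) τ := by
  obtain ⟨C, hC⟩ := exists_norm_integrand_le hA hP hP0 hu σ τ
  have h0 : Tendsto (fun t => Ring.inverse (P σ τ) * P σ t - 1) (𝓝 τ) (𝓝 0) := by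
    refine squeeze_zero_norm' (a := fun t => C * |t - τ| * |σ - σ₀|) ?_ ?_
    · filter_upwards [Icc_mem_nhds (sub_one_lt τ) (lt_add_one τ)] with t ht
      rw [inverse_mul_sub_one_eq_integral hA hP hP0 hu]
      exact intervalIntegral.norm_integral_le_of_norm_le_const
        fun s hs => hC t ht s (uIoc_subset_uIcc hs)
    · have : Continuous fun t : ℝ => C * |t - τ| * |σ - σ₀| := by fun_prop
      simpa using this.tendsto τ
  have h1 := (h0.const_mul (P σ τ)).add_const (P σ τ)
  have h : ∀ t, P σ τ * (Ring.inverse (P σ τ) * P σ t - 1) + P σ τ = P σ t := fun t => by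
    rw [mul_sub, ← mul_assoc, Ring.mul_inverse_cancel _ (hu σ τ)]
    simp
  simpa [ContinuousAt, h] using h1

/-- Differentiation of the solution of a linear equation with respect to a parameter. -/
theorem hasDerivAt_parameter (hA : ContDiff ℝ 1 fun p : ℝ × ℝ => A p.1 p.2)
    (hP : ∀ σ τ, HasDerivAt (fun s => P s τ) (A σ τ * P σ τ) σ) (hP0 : ∀ τ, P σ₀ τ = 1)
    (hu : ∀ σ τ, IsUnit (P σ τ)) (σ τ : ℝ) :
    HasDerivAt (fun t => P σ t)
      (P σ τ * ∫ s in σ₀..σ, Ring.inverse (P s τ) * deriv (fun t => A s t) τ * P s τ) τ := by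
  obtain ⟨C, hC⟩ := exists_norm_integrand_le hA hP hP0 hu σ τ
  have hcP : ∀ τ, Continuous fun s => P s τ := fun τ =>
    continuous_iff_continuousAt.2 fun s => (hP s τ).continuousAt
  have hcI : Continuous fun s => Ring.inverse (P s τ) :=
    continuous_iff_continuousAt.2 fun s => ((hP s τ).ringInverse (hu s τ)).continuousAt
  have hcA : ∀ t, Continuous fun s => A s t := fun t =>
    continuous_iff_continuousAt.2 fun s => (hA.hasDerivAt_fst s t).continuousAt
  have hd : HasDerivAt (fun t => Ring.inverse (P σ τ) * P σ t)
      (∫ s in σ₀..σ, Ring.inverse (P s τ) * deriv (fun t => A s t) τ * P s τ) τ := by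
    rw [hasDerivAt_iff_tendsto_slope]
    have hs : ∀ t, slope (fun t => Ring.inverse (P σ τ) * P σ t) τ t =
        ∫ s in σ₀..σ, (t - τ)⁻¹ • (Ring.inverse (P s τ) * (A s t - A s τ) * P s t) := fun t => by
      rw [intervalIntegral.integral_smul, ← inverse_mul_sub_one_eq_integral hA hP hP0 hu,
        slope_def_module, Ring.inverse_mul_cancel _ (hu σ τ)]
    rw [funext hs]
    have hnear : ∀ᶠ t in 𝓝[≠] τ, t ∈ Icc (τ - 1) (τ + 1) :=
      nhdsWithin_le_nhds (Icc_mem_nhds (sub_one_lt τ) (lt_add_one τ))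
    refine intervalIntegral.tendsto_integral_filter_of_dominated_convergence (fun _ => C)
      (.of_forall fun t => ?_) ?_ intervalIntegrable_const (.of_forall fun s _ => ?_)
    · exact (((hcI.mul ((hcA t).sub (hcA τ))).mul (hcP t)).const_smul _).aestronglyMeasurable
    · filter_upwards [hnear, self_mem_nhdsWithin] with t ht htne
      refine .of_forall fun s hs => ?_
      have hpos : 0 < |t - τ| := abs_pos.2 (sub_ne_zero.2 htne)
      rw [norm_smul, norm_inv, Real.norm_eq_abs, inv_mul_le_iff₀ hpos, mul_comm]
      exact hC t ht s (uIoc_subset_uIcc hs)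
    · have h1 := hasDerivAt_iff_tendsto_slope.1
        (hA.hasDerivAt_snd s τ).differentiableAt.hasDerivAt
      have h2 := (continuousAt_parameter hA hP hP0 hu s τ).tendsto.mono_left
        (nhdsWithin_le_nhds (s := {τ}ᶜ))
      refine ((h1.const_mul (Ring.inverse (P s τ))).mul h2).congr fun t => ?_
      rw [slope_def_module, mul_smul_comm, smul_mul_assoc]
  refine (hd.const_mul (P σ τ)).congr_of_eventuallyEq (.of_forall fun t => ?_)
  simp only
  rw [← mul_assoc, Ring.mul_inverse_cancel _ (hu σ τ), one_mul]

end Parameter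

/-- The surface formula for the logarithmic derivative of the Wilson loop in a Banach algebra. -/
theorem hasDerivAt_wilsonLoop {A₀ A₁ P Q : ℝ → ℝ → R} {σ₀ : ℝ}
    (hA₀ : ContDiff ℝ 1 fun p : ℝ × ℝ => A₀ p.1 p.2)
    (hA₁ : ContDiff ℝ 1 fun p : ℝ × ℝ => A₁ p.1 p.2)
    (hP : ∀ σ τ, HasDerivAt (fun s => P s τ) (A₁ σ τ * P σ τ) σ) (hP0 : ∀ τ, P σ₀ τ = 1)
    (hPu : ∀ σ τ, IsUnit (P σ τ))
    (hQ : ∀ σ τ, HasDerivAt (fun t => Q σ t) (A₀ σ τ * Q σ τ) τ)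
    (hQu : ∀ σ τ, IsUnit (Q σ τ)) (B : R) (σ τ : ℝ) :
    HasDerivAt (fun t => Ring.inverse (P σ t * Q σ₀ t) * Q σ t * B)
      ((∫ s in σ₀..σ, Ring.inverse (P s τ * Q σ₀ τ) *
          (deriv (fun s' => A₀ s' τ) s - deriv (fun t => A₁ s t) τ +
            (A₀ s τ * A₁ s τ - A₁ s τ * A₀ s τ)) * (P s τ * Q σ₀ τ)) *
        (Ring.inverse (P σ τ * Q σ₀ τ) * Q σ τ * B)) τ := by
  have hTu : ∀ s, IsUnit (P s τ * Q σ₀ τ) := fun s => (hPu s τ).mul (hQu σ₀ τ)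
  have hTs : ∀ s, HasDerivAt (fun s => P s τ * Q σ₀ τ) (A₁ s τ * (P s τ * Q σ₀ τ)) s :=
    fun s => ((hP s τ).mul_const (Q σ₀ τ)).congr_deriv (mul_assoc _ _ _)
  have hcT : Continuous fun s => P s τ * Q σ₀ τ :=
    continuous_iff_continuousAt.2 fun s => (hTs s).continuousAt
  have hcTI : Continuous fun s => Ring.inverse (P s τ * Q σ₀ τ) :=
    continuous_iff_continuousAt.2 fun s => ((hTs s).ringInverse (hTu s)).continuousAt
  have hcP : Continuous fun s => P s τ :=
    continuous_iff_continuousAt.2 fun s => (hP s τ).continuousAt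
  have hcPI : Continuous fun s => Ring.inverse (P s τ) :=
    continuous_iff_continuousAt.2 fun s => ((hP s τ).ringInverse (hPu s τ)).continuousAt
  have hpair : Continuous fun s : ℝ => (s, τ) := by fun_prop
  have hcA₀ : Continuous fun s => A₀ s τ := hA₀.continuous.comp hpair
  have hcA₁ : Continuous fun s => A₁ s τ := hA₁.continuous.comp hpair
  have hcD₀ : Continuous fun s => deriv (fun s' => A₀ s' τ) s :=
    hA₀.continuous_deriv_fst.comp hpair
  have hcD₁ : Continuous fun s => deriv (fun t => A₁ s t) τ :=
    hA₁.continuous_deriv_snd.comp hpair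
  have hinv : ∀ s, Ring.inverse (P s τ * Q σ₀ τ) =
      Ring.inverse (Q σ₀ τ) * Ring.inverse (P s τ) := fun s => by
    obtain ⟨p, hp⟩ := hPu s τ
    obtain ⟨q, hq⟩ := hQu σ₀ τ
    rw [← hp, ← hq, ← Units.val_mul, Ring.inverse_unit, Ring.inverse_unit, Ring.inverse_unit,
      mul_inv_rev, Units.val_mul]
  set J : ℝ → R := fun σ =>
    ∫ s in σ₀..σ, Ring.inverse (P s τ) * deriv (fun t => A₁ s t) τ * P s τ with hJ
  have hJd : ∀ s, HasDerivAt J (Ring.inverse (P s τ) * deriv (fun t => A₁ s t) τ * P s τ) s :=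
    fun s => ((hcPI.mul hcD₁).mul hcP).integral_hasStrictDerivAt σ₀ s |>.hasDerivAt
  have hint : (∫ s in σ₀..σ, Ring.inverse (P s τ * Q σ₀ τ) *
          (deriv (fun s' => A₀ s' τ) s - deriv (fun t => A₁ s t) τ +
            (A₀ s τ * A₁ s τ - A₁ s τ * A₀ s τ)) * (P s τ * Q σ₀ τ)) =
      Ring.inverse (P σ τ * Q σ₀ τ) * A₀ σ τ * (P σ τ * Q σ₀ τ)
        - Ring.inverse (Q σ₀ τ) * J σ * Q σ₀ τ
        - Ring.inverse (Q σ₀ τ) * A₀ σ₀ τ * Q σ₀ τ := by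
    have hd : ∀ s, HasDerivAt
        (fun s => Ring.inverse (P s τ * Q σ₀ τ) * A₀ s τ * (P s τ * Q σ₀ τ)
          - Ring.inverse (Q σ₀ τ) * J s * Q σ₀ τ)
        (Ring.inverse (P s τ * Q σ₀ τ) *
          (deriv (fun s' => A₀ s' τ) s - deriv (fun t => A₁ s t) τ +
            (A₀ s τ * A₁ s τ - A₁ s τ * A₀ s τ)) * (P s τ * Q σ₀ τ)) s := fun s => by
      refine ((((hTs s).ringInverse (hTu s)).mul
        (hA₀.hasDerivAt_fst s τ).differentiableAt.hasDerivAt).mul (hTs s)).sub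
        (((hJd s).const_mul (Ring.inverse (Q σ₀ τ))).mul_const (Q σ₀ τ)) |>.congr_deriv ?_
      have hc := Ring.mul_inverse_cancel _ (hTu s)
      have hr : Ring.inverse (Q σ₀ τ) *
          (Ring.inverse (P s τ) * deriv (fun t => A₁ s t) τ * P s τ) * Q σ₀ τ =
          Ring.inverse (P s τ * Q σ₀ τ) * deriv (fun t => A₁ s t) τ * (P s τ * Q σ₀ τ) := by
        rw [hinv]
        noncomm_ring
      rw [hr, Pi.mul_apply]
      generalize P s τ * Q σ₀ τ = X at hc ⊢
      rw [mul_assoc _ (A₁ s τ * X), mul_assoc (A₁ s τ), hc]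
      noncomm_ring
    rw [intervalIntegral.integral_eq_sub_of_hasDerivAt (fun s _ => hd s)
      (((hcTI.mul ((hcD₀.sub hcD₁).add ((hcA₀.mul hcA₁).sub (hcA₁.mul hcA₀)))).mul
        hcT).intervalIntegrable _ _)]
    simp [hP0, hJ]
  rw [hint]
  have hTt := (hasDerivAt_parameter hA₁ hP hP0 hPu σ τ).mul (hQ σ₀ τ)
  refine (((hTt.ringInverse (hTu σ)).mul (hQ σ τ)).mul_const B).congr_deriv ?_
  have hc := Ring.mul_inverse_cancel _ (hTu σ)
  have e₁ : P σ τ * J σ * Q σ₀ τ + P σ τ * (A₀ σ₀ τ * Q σ₀ τ) =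
      (P σ τ * Q σ₀ τ) * (Ring.inverse (Q σ₀ τ) * J σ * Q σ₀ τ +
        Ring.inverse (Q σ₀ τ) * A₀ σ₀ τ * Q σ₀ τ) := by
    have hq := Ring.mul_inverse_cancel _ (hQu σ₀ τ)
    calc _ = P σ τ * (Q σ₀ τ * Ring.inverse (Q σ₀ τ)) * J σ * Q σ₀ τ +
          P σ τ * (Q σ₀ τ * Ring.inverse (Q σ₀ τ)) * A₀ σ₀ τ * Q σ₀ τ := by
            rw [hq]; noncomm_ring
      _ = _ := by noncomm_ring
  change (-(Ring.inverse (P σ τ * Q σ₀ τ) * (P σ τ * J σ * Q σ₀ τ + P σ τ * (A₀ σ₀ τ * Q σ₀ τ)) *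
    Ring.inverse (P σ τ * Q σ₀ τ)) * Q σ τ +
      Ring.inverse (P σ τ * Q σ₀ τ) * (A₀ σ τ * Q σ τ)) * B = _
  have hc' := Ring.inverse_mul_cancel _ (hTu σ)
  rw [e₁]
  generalize Ring.inverse (Q σ₀ τ) * J σ * Q σ₀ τ = Y
  generalize Ring.inverse (Q σ₀ τ) * A₀ σ₀ τ * Q σ₀ τ = Z
  generalize P σ τ * Q σ₀ τ = X at hc hc' ⊢
  generalize Ring.inverse X = V at hc hc' ⊢
  calc _ = (-((V * X) * (Y + Z) * V) * Q σ τ + V * (A₀ σ τ * Q σ τ)) * B := by noncomm_ring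
    _ = (-((Y + Z) * V) * Q σ τ + V * A₀ σ τ * (X * V) * Q σ τ) * B := by
      rw [hc, hc']; noncomm_ring
    _ = _ := by noncomm_ring

end BanachAlgebra

/-- The τ-derivative of the Wilson loop operator exists and satisfies
`∂_τ W * W⁻¹ = ∫_{σ₀}^{σ} T⁻¹(σ',τ) F₀₁(σ',τ) T(σ',τ) dσ'`, where
`F₀₁ = ∂_σ A₀ − ∂_τ A₁ + [A₀, A₁]`. -/
theorem wilson_loop_L_deriv_surface
    (n : ℕ) (hn : 1 ≤ n)
    (A₀ A₁ : ℝ → ℝ → Matrix (Fin n) (Fin n) ℂ)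
    (hA₀ : ContDiff ℝ 1 fun p : ℝ × ℝ => A₀ p.1 p.2)
    (hA₁ : ContDiff ℝ 1 fun p : ℝ × ℝ => A₁ p.1 p.2)
    (σ₀ τ₀ : ℝ)
    (P Q : ℝ → ℝ → Matrix (Fin n) (Fin n) ℂ)
    (hP : ∀ (σ τ : ℝ), HasDerivAt (fun σ' : ℝ => P σ' τ) (A₁ σ τ * P σ τ) σ)
    (hP0 : ∀ τ : ℝ, P σ₀ τ = 1)
    (hPinv : ∀ (σ τ : ℝ), IsUnit (P σ τ))
    (hQ : ∀ (σ τ : ℝ), HasDerivAt (fun τ' : ℝ => Q σ τ') (A₀ σ τ * Q σ τ) τ)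
    (hQ0 : ∀ σ : ℝ, Q σ τ₀ = 1)
    (hQinv : ∀ (σ τ : ℝ), IsUnit (Q σ τ))
    (T : ℝ → ℝ → Matrix (Fin n) (Fin n) ℂ)
    (hT : ∀ (σ τ : ℝ), T σ τ = P σ τ * Q σ₀ τ)
    (W : ℝ → ℝ → Matrix (Fin n) (Fin n) ℂ)
    (hW : ∀ (σ τ : ℝ), W σ τ = (T σ τ)⁻¹ * Q σ τ * P σ τ₀) :
    ∀ (σ τ : ℝ),
      DifferentiableAt ℝ (fun τ' : ℝ => W σ τ') τ ∧
      deriv (fun τ' : ℝ => W σ τ') τ * (W σ τ)⁻¹ =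
        ∫ σ' in σ₀..σ,
          (T σ' τ)⁻¹ *
            (deriv (fun s : ℝ => A₀ s τ) σ' - deriv (fun t : ℝ => A₁ σ' t) τ +
              (A₀ σ' τ * A₁ σ' τ - A₁ σ' τ * A₀ σ' τ)) * T σ' τ := by
  intro σ τ
  have : CompleteSpace (Matrix (Fin n) (Fin n) ℂ) := FiniteDimensional.complete ℝ _
  have key := hasDerivAt_wilsonLoop hA₀ hA₁ hP hP0 hPinv hQ hQinv (P σ τ₀) σ τ
  simp_rw [← Matrix.nonsing_inv_eq_ringInverse, ← hT, ← hW] at key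
  have hTu : IsUnit (T σ τ) := hT σ τ ▸ (hPinv σ τ).mul (hQinv σ₀ τ)
  have hWu : IsUnit (W σ τ) := by
    rw [hW]
    exact (((Matrix.isUnit_nonsing_inv_iff).2 hTu).mul (hQinv σ τ)).mul (hPinv σ τ₀)
  refine ⟨key.differentiableAt, (congrArg (· * (W σ τ)⁻¹) key.deriv).trans ?_⟩
  exact Matrix.mul_nonsing_inv_cancel_right _ _ ((Matrix.isUnit_iff_isUnit_det _).1 hWu)
end

section
/- With the Wilson-loop setup below and a gauge transformation g : ℝ × ℝ → Matrix (Fin n) (Fin n) ℂ (continuously differentiable with invertible values), let A₀ᵍ = g * A₀ * g⁻¹ − g * ∂_τ(g⁻¹), A₁ᵍ = g * A₁ * g⁻¹ − g * ∂_σ(g⁻¹), and let Wᵍ be the Wilson loop operator constructed from A₀ᵍ, A₁ᵍ exactly as W is constructed from A₀, A₁. Then for all (σ, τ): Wᵍ(σ, τ) = g(σ₀, τ₀) * W(σ, τ) * g(σ₀, τ₀)⁻¹; that is, the Wilson loop operator transforms covariantly under gauge transformations, conjugated by the value of g at the base point. -/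
attribute [local instance] Matrix.linftyOpNormedAddCommGroup Matrix.linftyOpNormedRing
  Matrix.linftyOpNormedSpace Matrix.linftyOpNormedAlgebra

/-- If `h` differentiates to `h'` and takes invertible values, the pointwise inverse is
differentiable. -/
theorem HasDerivAt.ringInverse_s19 {R : Type*} [NormedRing R] [HasSummableGeomSeries R]
    [NormedAlgebra ℝ R] {h : ℝ → R} {h' : R} {t : ℝ} (hh : HasDerivAt h h' t)
    (hu : IsUnit (h t)) :
    HasDerivAt (fun s => Ring.inverse (h s))
      (-(Ring.inverse (h t) * h' * Ring.inverse (h t))) t := by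
  obtain ⟨u, hu⟩ := hu
  have hinv := hasFDerivAt_ringInverse (𝕜 := ℝ) u
  rw [hu] at hinv
  simpa [Function.comp_def, ← hu] using hinv.comp_hasDerivAt t hh

/-- Parallel transport along a line is conjugated, at its two ends, by a gauge transformation. -/
theorem parallelTransport_gauge {R : Type*} [NormedRing R] [HasSummableGeomSeries R]
    [NormedAlgebra ℝ R] {a h h' U V : ℝ → R} {t₀ : ℝ}
    (hh : ∀ t, HasDerivAt h (h' t) t) (hhu : ∀ t, IsUnit (h t))
    (hU : ∀ t, HasDerivAt U (a t * U t) t) (hUu : ∀ t, IsUnit (U t)) (hU₀ : U t₀ = 1)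
    (hV : ∀ t, HasDerivAt V ((h t * a t * Ring.inverse (h t)
      - h t * deriv (fun s => Ring.inverse (h s)) t) * V t) t) (hV₀ : V t₀ = 1) (t : ℝ) :
    V t = h t * U t * Ring.inverse (h t₀) := by
  set K : ℝ → R := fun s => Ring.inverse (U s) * Ring.inverse (h s) * V s with hK
  have hK' : ∀ s, HasDerivAt K 0 s := fun s => by
    have hd := ((hh s).ringInverse_s19 (hhu s)).differentiableAt.hasDerivAt
    have hU' : HasDerivAt (fun r => Ring.inverse (U r)) (-(Ring.inverse (U s) * a s)) s := by
      have := (hU s).ringInverse_s19 (hUu s)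
      rwa [mul_assoc, mul_assoc, Ring.mul_inverse_cancel _ (hUu s), mul_one] at this
    refine ((hU'.mul hd).mul (hV s)).congr_deriv ?_
    have hinv := Ring.inverse_mul_cancel _ (hhu s)
    have hcancel : ∀ x, Ring.inverse (h s) * (h s * x) = x := fun x => by
      rw [← mul_assoc, hinv, one_mul]
    simp only [Pi.mul_apply, sub_mul, mul_sub, add_mul, neg_mul, mul_assoc, hcancel]
    abel
  have hconst : K t = K t₀ :=
    is_const_of_deriv_eq_zero (fun s => (hK' s).differentiableAt) (fun s => (hK' s).deriv) t t₀
  simp only [hK, hU₀, hV₀, Ring.inverse_one, one_mul, mul_one] at hconst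
  rw [← hconst, mul_assoc, mul_assoc, ← mul_assoc (U t), Ring.mul_inverse_cancel _ (hUu t),
    one_mul, ← mul_assoc, Ring.mul_inverse_cancel _ (hhu t), one_mul]

/-- Gauge covariance of the Wilson loop operator:
`Wᵍ(σ,τ) = g(σ₀,τ₀) W(σ,τ) g(σ₀,τ₀)⁻¹`. -/
theorem wilson_loop_gauge_covariant
    (n : ℕ) (hn : 1 ≤ n)
    (A₀ A₁ : ℝ → ℝ → Matrix (Fin n) (Fin n) ℂ)
    (hA₀ : ContDiff ℝ 1 fun p : ℝ × ℝ => A₀ p.1 p.2)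
    (hA₁ : ContDiff ℝ 1 fun p : ℝ × ℝ => A₁ p.1 p.2)
    (σ₀ τ₀ : ℝ)
    (P Q : ℝ → ℝ → Matrix (Fin n) (Fin n) ℂ)
    (hP : ∀ (σ τ : ℝ), HasDerivAt (fun σ' : ℝ => P σ' τ) (A₁ σ τ * P σ τ) σ)
    (hP0 : ∀ τ : ℝ, P σ₀ τ = 1)
    (hPinv : ∀ (σ τ : ℝ), IsUnit (P σ τ))
    (hQ : ∀ (σ τ : ℝ), HasDerivAt (fun τ' : ℝ => Q σ τ') (A₀ σ τ * Q σ τ) τ)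
    (hQ0 : ∀ σ : ℝ, Q σ τ₀ = 1)
    (hQinv : ∀ (σ τ : ℝ), IsUnit (Q σ τ))
    (T : ℝ → ℝ → Matrix (Fin n) (Fin n) ℂ)
    (hT : ∀ (σ τ : ℝ), T σ τ = P σ τ * Q σ₀ τ)
    (W : ℝ → ℝ → Matrix (Fin n) (Fin n) ℂ)
    (hW : ∀ (σ τ : ℝ), W σ τ = (T σ τ)⁻¹ * Q σ τ * P σ τ₀)
    (g : ℝ → ℝ → Matrix (Fin n) (Fin n) ℂ)
    (hg : ContDiff ℝ 1 fun p : ℝ × ℝ => g p.1 p.2)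
    (hginv : ∀ (σ τ : ℝ), IsUnit (g σ τ))
    (A₀g A₁g : ℝ → ℝ → Matrix (Fin n) (Fin n) ℂ)
    (hA₀g : ∀ (σ τ : ℝ), A₀g σ τ =
      g σ τ * A₀ σ τ * (g σ τ)⁻¹ - g σ τ * deriv (fun τ' : ℝ => (g σ τ')⁻¹) τ)
    (hA₁g : ∀ (σ τ : ℝ), A₁g σ τ =
      g σ τ * A₁ σ τ * (g σ τ)⁻¹ - g σ τ * deriv (fun σ' : ℝ => (g σ' τ)⁻¹) σ)
    (Pg Qg : ℝ → ℝ → Matrix (Fin n) (Fin n) ℂ)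
    (hPg : ∀ (σ τ : ℝ), HasDerivAt (fun σ' : ℝ => Pg σ' τ) (A₁g σ τ * Pg σ τ) σ)
    (hPg0 : ∀ τ : ℝ, Pg σ₀ τ = 1)
    (hPginv : ∀ (σ τ : ℝ), IsUnit (Pg σ τ))
    (hQg : ∀ (σ τ : ℝ), HasDerivAt (fun τ' : ℝ => Qg σ τ') (A₀g σ τ * Qg σ τ) τ)
    (hQg0 : ∀ σ : ℝ, Qg σ τ₀ = 1)
    (hQginv : ∀ (σ τ : ℝ), IsUnit (Qg σ τ))
    (Tg : ℝ → ℝ → Matrix (Fin n) (Fin n) ℂ)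
    (hTg : ∀ (σ τ : ℝ), Tg σ τ = Pg σ τ * Qg σ₀ τ)
    (Wg : ℝ → ℝ → Matrix (Fin n) (Fin n) ℂ)
    (hWg : ∀ (σ τ : ℝ), Wg σ τ = (Tg σ τ)⁻¹ * Qg σ τ * Pg σ τ₀) :
    ∀ (σ τ : ℝ), Wg σ τ = g σ₀ τ₀ * W σ τ * (g σ₀ τ₀)⁻¹ := by
  have hgdiff : Differentiable ℝ fun p : ℝ × ℝ => g p.1 p.2 := hg.differentiable one_ne_zero
  have hgσ : ∀ σ τ, HasDerivAt (fun s => g s τ) (deriv (fun s => g s τ) σ) σ := fun σ τ =>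
    (DifferentiableAt.comp σ (f := fun s : ℝ => (s, τ)) (hgdiff (σ, τ))
      (by fun_prop)).hasDerivAt
  have hgτ : ∀ σ τ, HasDerivAt (fun t => g σ t) (deriv (fun t => g σ t) τ) τ := fun σ τ =>
    (DifferentiableAt.comp τ (f := fun t : ℝ => (σ, t)) (hgdiff (σ, τ))
      (by fun_prop)).hasDerivAt
  simp only [hA₀g, Matrix.nonsing_inv_eq_ringInverse] at hQg
  simp only [hA₁g, Matrix.nonsing_inv_eq_ringInverse] at hPg
  have hPeq : ∀ σ τ, Pg σ τ = g σ τ * P σ τ * (g σ₀ τ)⁻¹ := fun σ τ => by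
    rw [Matrix.nonsing_inv_eq_ringInverse]
    exact parallelTransport_gauge (fun s => hgσ s τ) (fun s => hginv s τ) (fun s => hP s τ)
      (fun s => hPinv s τ) (hP0 τ) (fun s => hPg s τ) (hPg0 τ) σ
  have hQeq : ∀ σ τ, Qg σ τ = g σ τ * Q σ τ * (g σ τ₀)⁻¹ := fun σ τ => by
    rw [Matrix.nonsing_inv_eq_ringInverse]
    exact parallelTransport_gauge (fun t => hgτ σ t) (fun t => hginv σ t) (fun t => hQ σ t)
      (fun t => hQinv σ t) (hQ0 σ) (fun t => hQg σ t) (hQg0 σ) τ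
  have hdet : ∀ σ τ, IsUnit (g σ τ).det := fun σ τ =>
    (Matrix.isUnit_iff_isUnit_det _).mp (hginv σ τ)
  intro σ τ
  have hTeq : Tg σ τ = g σ τ * T σ τ * (g σ₀ τ₀)⁻¹ := by
    rw [hTg, hT, hPeq, hQeq]
    simp only [Matrix.mul_assoc, Matrix.nonsing_inv_mul_cancel_left _ _ (hdet σ₀ τ)]
  rw [hWg, hW, hTeq, hPeq, hQeq, Matrix.mul_inv_rev, Matrix.mul_inv_rev,
    Matrix.nonsing_inv_nonsing_inv _ (hdet σ₀ τ₀)]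
  simp only [Matrix.mul_assoc, Matrix.nonsing_inv_mul_cancel_left _ _ (hdet _ _)]
end
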